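/- There exists a deterministic online algorithm for OMSS(2,2) that is (5/3)-competitive. -/

import Mathlib

open Finset

/-- An instance of Online Makespan Scheduling under Scenarios with `K` scenarios:
`n` jobs `1,…,n`, nonnegative processing times `p`, and scenarios `S k ⊆ {1,…,n}`. -/
structure OMSSInstance (K : ℕ) where
  n : ℕ
  p : ℕ → ℝ
  hp : ∀ j, 0 ≤ p j
  S : Fin K → Finset ℕ
  hS : ∀ k, S k ⊆ Finset.Icc 1 n

/-- A deterministic online algorithm for `OMSS(m,K)`: the machine for job `j` is a
function only of `j`, the processing times revealed so far, and the partial scenarios. -/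
abbrev OnlineAlg (m K : ℕ) := ℕ → (ℕ → ℝ) → (Fin K → Finset ℕ) → Fin m

/-- The assignment produced by online algorithm `A` on instance `I`:
for job `j` the algorithm only sees `p_1,…,p_j` and `S_k ∩ [j]`. -/
noncomputable def algAssign {m K : ℕ} (A : OnlineAlg m K) (I : OMSSInstance K) : ℕ → Fin m :=
  fun j => A j (fun j' => if j' ≤ j then I.p j' else 0) (fun k => I.S k ∩ Finset.Icc 1 j)

/-- Load of machine `i` in scenario `k` under assignment `τ`. -/
noncomputable def load {m K : ℕ} (I : OMSSInstance K) (τ : ℕ → Fin m) (i : Fin m)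
    (k : Fin K) : ℝ :=
  ∑ j ∈ (I.S k).filter (fun j => τ j = i), I.p j

/-- Makespan of an assignment: the largest load of a machine in a scenario. -/
noncomputable def mkspan {m K : ℕ} (I : OMSSInstance K) (τ : ℕ → Fin m) : ℝ :=
  sSup {x | ∃ k : Fin K, ∃ i : Fin m, x = load I τ i k}

/-- Offline optimum makespan over all assignments to `m` machines. -/
noncomputable def OPT (m : ℕ) {K : ℕ} (I : OMSSInstance K) : ℝ :=
  sInf {x | ∃ τ : ℕ → Fin m, x = mkspan I τ}

/-- The configurations avoided by the algorithm, for one of the four ways of ordering machines and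
scenarios. The loads on the two machines are `a₁, a₂` in the first scenario and `b₁, b₂` in the
second one, and `q` is the largest job size so far. -/
def IsBad (a₁ a₂ b₁ b₂ q : ℝ) : Prop :=
  (5 * (a₁ + a₂) < 6 * a₁ ∧ 5 * (b₁ + b₂) < 6 * a₁ ∧ 10 * q < 6 * a₁) ∨
  (2 * (a₁ + a₂) < 3 * a₁ ∧ 2 * (b₁ + b₂) < 3 * a₁ ∧ 2 * (a₁ + a₂) < a₁ + 2 * b₂ ∧
    2 * (b₁ + b₂) < a₁ + 2 * b₂) ∨
  (2 * b₁ < a₁ ∧ 2 * b₂ < b₁ ∧ a₁ + a₂ < 3 * b₁ ∧ 2 * q < 3 * b₁) ∨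
  (4 * (a₂ + b₁) < a₁ ∧ 4 * b₂ < a₁ ∧ 4 * q < 3 * a₁)

/-- The symmetric closure of `IsBad` under swapping machines and swapping scenarios. -/
def IsRisky (a₁ a₂ b₁ b₂ q : ℝ) : Prop :=
  (IsBad a₁ a₂ b₁ b₂ q ∨ IsBad a₂ a₁ b₂ b₁ q) ∨ (IsBad b₁ b₂ a₁ a₂ q ∨ IsBad b₂ b₁ a₂ a₁ q)

theorem IsRisky.swap_scenarios {a₁ a₂ b₁ b₂ q : ℝ} (h : IsRisky a₁ a₂ b₁ b₂ q) :
    IsRisky b₁ b₂ a₁ a₂ q :=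
  h.symm

theorem not_isRisky_zero : ¬ IsRisky 0 0 0 0 0 := by
  norm_num [IsRisky, IsBad]

set_option maxHeartbeats 4000000 in
-- The case analysis compares all pairs of bad configurations.
/-- A job that belongs to the second scenario can be placed safely. -/
theorem not_isRisky_add_of_eq_zero_or_eq {a₁ a₂ b₁ b₂ q q' u w : ℝ} (ha₁ : 0 ≤ a₁) (ha₂ : 0 ≤ a₂)
    (hb₁ : 0 ≤ b₁) (hb₂ : 0 ≤ b₂) (hw : 0 ≤ w) (hq : q ≤ q') (hwq : w ≤ q')
    (hu : u = 0 ∨ u = w) (h : ¬ IsRisky a₁ a₂ b₁ b₂ q)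
    (h₁ : IsRisky (a₁ + u) a₂ (b₁ + w) b₂ q') : ¬ IsRisky a₁ (a₂ + u) b₁ (b₂ + w) q' := by
  intro h₂
  simp only [IsRisky, IsBad, not_or] at h
  obtain ⟨⟨⟨n0, n1, n2, n3⟩, ⟨n4, n5, n6, n7⟩⟩, ⟨⟨n8, n9, n10, n11⟩, ⟨n12, n13, n14, n15⟩⟩⟩ := h
  rcases hu with rfl | rfl <;>
  rcases h₁ with ((h₁ | h₁ | h₁ | h₁) | (h₁ | h₁ | h₁ | h₁)) |
    ((h₁ | h₁ | h₁ | h₁) | (h₁ | h₁ | h₁ | h₁)) <;>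
  rcases h₂ with ((h₂ | h₂ | h₂ | h₂) | (h₂ | h₂ | h₂ | h₂)) |
    ((h₂ | h₂ | h₂ | h₂) | (h₂ | h₂ | h₂ | h₂)) <;>
  casesm* _ ∧ _ <;>
  first
  | linarith
  | (refine n0 ⟨?_, ?_, ?_⟩ <;> linarith)
  | (refine n4 ⟨?_, ?_, ?_⟩ <;> linarith)
  | (refine n8 ⟨?_, ?_, ?_⟩ <;> linarith)
  | (refine n12 ⟨?_, ?_, ?_⟩ <;> linarith)
  | (refine n1 ⟨?_, ?_, ?_, ?_⟩ <;> linarith)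
  | (refine n5 ⟨?_, ?_, ?_, ?_⟩ <;> linarith)
  | (refine n9 ⟨?_, ?_, ?_, ?_⟩ <;> linarith)
  | (refine n13 ⟨?_, ?_, ?_, ?_⟩ <;> linarith)
  | (refine n2 ⟨?_, ?_, ?_, ?_⟩ <;> linarith)
  | (refine n6 ⟨?_, ?_, ?_, ?_⟩ <;> linarith)
  | (refine n10 ⟨?_, ?_, ?_, ?_⟩ <;> linarith)
  | (refine n14 ⟨?_, ?_, ?_, ?_⟩ <;> linarith)
  | (refine n3 ⟨?_, ?_, ?_⟩ <;> linarith)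
  | (refine n7 ⟨?_, ?_, ?_⟩ <;> linarith)
  | (refine n11 ⟨?_, ?_, ?_⟩ <;> linarith)
  | (refine n15 ⟨?_, ?_, ?_⟩ <;> linarith)
  | (simp only [not_and_or, not_lt] at n1 n5 n9 n13
     first
     | (rcases n1 with n | n | n | n <;> rcases n13 with n' | n' | n' | n' <;> linarith)
     | (rcases n5 with n | n | n | n <;> rcases n9 with n' | n' | n' | n' <;> linarith))

/-- The data the algorithm keeps: the load of each machine in each scenario, and the size of the
largest job so far. -/
structure LoadState where
  load : Fin 2 → Fin 2 → ℝ
  maxSize : ℝ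

namespace LoadState

/-- Whether the algorithm wants to stay away from this state. -/
def Risky (s : LoadState) : Prop :=
  IsRisky (s.load 0 0) (s.load 1 0) (s.load 0 1) (s.load 1 1) s.maxSize

/-- Place on machine `i` a job of size `v k` in scenario `k`. -/
noncomputable def place (s : LoadState) (i : Fin 2) (v : Fin 2 → ℝ) : LoadState where
  load i' k := s.load i' k + if i = i' then v k else 0
  maxSize := max s.maxSize (max (v 0) (v 1))

open Classical in
/-- The machine on which the algorithm places a job: the first one if that is safe. -/
noncomputable def choice (s : LoadState) (v : Fin 2 → ℝ) : Fin 2 :=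
  if (s.place 0 v).Risky then 1 else 0

theorem not_risky_place_choice {s : LoadState} {v : Fin 2 → ℝ} (hs : ∀ i k, 0 ≤ s.load i k)
    (hv : ∀ k, 0 ≤ v k) (hv' : v 0 = 0 ∨ v 1 = 0 ∨ v 0 = v 1) (h : ¬ s.Risky) :
    ¬ (s.place (s.choice v) v).Risky := by
  by_cases h₀ : (s.place 0 v).Risky
  · simp only [choice, h₀, if_true]
    simp only [Risky, place] at *
    simp only [Fin.isValue, if_true, one_ne_zero, zero_ne_one, if_false, add_zero] at *
    have hq := le_max_left s.maxSize (max (v 0) (v 1))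
    have hq₀ := (le_max_left (v 0) (v 1)).trans (le_max_right s.maxSize _)
    have hq₁ := (le_max_right (v 0) (v 1)).trans (le_max_right s.maxSize _)
    by_cases hv₁ : v 0 = 0 ∨ v 0 = v 1
    · exact not_isRisky_add_of_eq_zero_or_eq (hs 0 0) (hs 1 0) (hs 0 1) (hs 1 1) (hv 1) hq hq₁
        hv₁ h h₀
    · have hv₀ : v 1 = 0 ∨ v 1 = v 0 := by tauto
      exact fun h₁ ↦ not_isRisky_add_of_eq_zero_or_eq (hs 0 1) (hs 1 1) (hs 0 0) (hs 1 0) (hv 0)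
        hq hq₀ hv₀ (fun h' ↦ h h'.swap_scenarios) h₀.swap_scenarios h₁.swap_scenarios
  · simpa only [choice, h₀, if_false] using h₀

/-- In a safe state every load is at most `5 / 3` times any bound for the optimum. -/
theorem load_le_of_not_risky {s : LoadState} (h : ¬ s.Risky) {M : ℝ}
    (hM : ∀ k, s.load 0 k + s.load 1 k ≤ 2 * M) (hq : s.maxSize ≤ M) (i k : Fin 2) :
    s.load i k ≤ 5 / 3 * M := by
  by_contra! hlt
  simp only [Risky, IsRisky, IsBad, not_or] at h
  obtain ⟨⟨⟨h₀₀, -⟩, ⟨h₁₀, -⟩⟩, ⟨⟨h₀₁, -⟩, ⟨h₁₁, -⟩⟩⟩ := h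
  have hM₀ := hM 0
  have hM₁ := hM 1
  fin_cases i <;> fin_cases k <;> simp only [Fin.zero_eta, Fin.mk_one, Fin.isValue] at hlt
  · exact h₀₀ ⟨by linarith, by linarith, by linarith⟩
  · exact h₀₁ ⟨by linarith, by linarith, by linarith⟩
  · exact h₁₀ ⟨by linarith, by linarith, by linarith⟩
  · exact h₁₁ ⟨by linarith, by linarith, by linarith⟩

end LoadState

/-- The size of job `j` in each scenario. -/
noncomputable def jobSize {K : ℕ} (p : ℕ → ℝ) (S : Fin K → Finset ℕ) (j : ℕ) (k : Fin K) : ℝ :=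
  if j ∈ S k then p j else 0

/-- The state reached by the algorithm after jobs `1, …, j`. -/
noncomputable def stateAfter (p : ℕ → ℝ) (S : Fin 2 → Finset ℕ) : ℕ → LoadState
  | 0 => ⟨fun _ _ ↦ 0, 0⟩
  | j + 1 => (stateAfter p S j).place ((stateAfter p S j).choice (jobSize p S (j + 1)))
      (jobSize p S (j + 1))

theorem stateAfter_congr {p p' : ℕ → ℝ} {S S' : Fin 2 → Finset ℕ} {j : ℕ}
    (h : ∀ j' ∈ Icc 1 j, jobSize p S j' = jobSize p' S' j') :
    stateAfter p S j = stateAfter p' S' j := by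
  induction j with
  | zero => rfl
  | succ j ih =>
    rw [stateAfter, stateAfter, ih fun j' hj' ↦ h j' (Icc_subset_Icc_right j.le_succ hj'),
      h (j + 1) (by simp)]

/-- The algorithm recomputes the current state and makes a safe choice. -/
noncomputable def safeAlg : OnlineAlg 2 2 :=
  fun j p S ↦ (stateAfter p S (j - 1)).choice (jobSize p S j)

theorem algAssign_safeAlg_succ (I : OMSSInstance 2) (j : ℕ) :
    algAssign safeAlg I (j + 1) = (stateAfter I.p I.S j).choice (jobSize I.p I.S (j + 1)) := by
  have h : ∀ j' ∈ Icc 1 (j + 1), jobSize (fun j' ↦ if j' ≤ j + 1 then I.p j' else 0)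
      (fun k ↦ I.S k ∩ Icc 1 (j + 1)) j' = jobSize I.p I.S j' := by
    intro j' hj'
    ext k
    simp [jobSize, hj', (mem_Icc.mp hj').2]
  rw [algAssign, safeAlg, h (j + 1) (by simp), Nat.add_sub_cancel,
    stateAfter_congr fun j' hj' ↦ h j' (Icc_subset_Icc_right j.le_succ hj')]

section

variable (I : OMSSInstance 2)

theorem load_eq_sum_jobSize {m K : ℕ} (I : OMSSInstance K) (τ : ℕ → Fin m) (i : Fin m)
    (k : Fin K) : load I τ i k = ∑ j ∈ Icc 1 I.n, if τ j = i then jobSize I.p I.S j k else 0 := by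
  rw [load, sum_filter, ← sum_subset (I.hS k)]
  · exact sum_congr rfl fun j hj ↦ by simp [jobSize, hj]
  · intro j _ hj
    simp [jobSize, hj]

theorem stateAfter_load (j : ℕ) (i k : Fin 2) :
    (stateAfter I.p I.S j).load i k =
      ∑ j' ∈ Icc 1 j, if algAssign safeAlg I j' = i then jobSize I.p I.S j' k else 0 := by
  induction j with
  | zero => simp [stateAfter]
  | succ j ih =>
    rw [sum_Icc_succ_top (by lia), ← ih, algAssign_safeAlg_succ]
    rfl

theorem jobSize_nonneg {K : ℕ} (I : OMSSInstance K) (j : ℕ) (k : Fin K) :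
    0 ≤ jobSize I.p I.S j k := by
  unfold jobSize
  split_ifs
  exacts [I.hp j, le_rfl]

theorem not_risky_stateAfter (j : ℕ) : ¬ (stateAfter I.p I.S j).Risky := by
  induction j with
  | zero => exact not_isRisky_zero
  | succ j ih =>
    refine LoadState.not_risky_place_choice (fun i k ↦ ?_) (jobSize_nonneg I _) ?_ ih
    · rw [stateAfter_load]
      exact sum_nonneg fun j' _ ↦ by split_ifs; exacts [jobSize_nonneg I _ _, le_rfl]
    · unfold jobSize
      split_ifs <;> simp

theorem load_le_mkspan {m K : ℕ} (I : OMSSInstance K) (τ : ℕ → Fin m) (i : Fin m) (k : Fin K) :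
    load I τ i k ≤ mkspan I τ := by
  refine le_csSup (Set.Finite.bddAbove ?_) ⟨k, i, rfl⟩
  refine (Set.finite_range fun x : Fin K × Fin m ↦ load I τ x.2 x.1).subset ?_
  rintro _ ⟨k, i, rfl⟩
  exact ⟨(k, i), rfl⟩

theorem sum_load {m K : ℕ} (I : OMSSInstance K) (τ : ℕ → Fin m) (k : Fin K) :
    ∑ i, load I τ i k = ∑ j ∈ I.S k, I.p j :=
  sum_fiberwise _ _ _

theorem jobSize_le_mkspan {m K : ℕ} (I : OMSSInstance K) (τ : ℕ → Fin m) {j : ℕ}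
    (hj : j ∈ Icc 1 I.n) (k : Fin K) : jobSize I.p I.S j k ≤ mkspan I τ := by
  refine le_trans ?_ (load_le_mkspan I τ (τ j) k)
  rw [load_eq_sum_jobSize]
  refine le_trans (by simp)
    (single_le_sum (f := fun j' ↦ if τ j' = τ j then jobSize I.p I.S j' k else 0) ?_ hj)
  intro j' _
  split_ifs
  exacts [jobSize_nonneg I _ _, le_rfl]

theorem load_nonneg {m K : ℕ} (I : OMSSInstance K) (τ : ℕ → Fin m) (i : Fin m) (k : Fin K) :
    0 ≤ load I τ i k :=
  sum_nonneg fun j _ ↦ I.hp j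

theorem maxSize_stateAfter_le_mkspan (τ : ℕ → Fin 2) {j : ℕ} (hj : j ≤ I.n) :
    (stateAfter I.p I.S j).maxSize ≤ mkspan I τ := by
  induction j with
  | zero => exact (load_nonneg I τ 0 0).trans (load_le_mkspan I τ 0 0)
  | succ j ih =>
    have hj' : j + 1 ∈ Icc 1 I.n := mem_Icc.mpr ⟨by lia, hj⟩
    exact max_le (ih (by lia)) (max_le (jobSize_le_mkspan I τ hj' 0) (jobSize_le_mkspan I τ hj' 1))

theorem load_algAssign_safeAlg_le (τ : ℕ → Fin 2) (i k : Fin 2) :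
    load I (algAssign safeAlg I) i k ≤ 5 / 3 * mkspan I τ := by
  have hload : ∀ i k, (stateAfter I.p I.S I.n).load i k = load I (algAssign safeAlg I) i k :=
    fun i k ↦ by rw [stateAfter_load, load_eq_sum_jobSize]
  rw [← hload]
  refine LoadState.load_le_of_not_risky (not_risky_stateAfter I I.n) (fun k ↦ ?_)
    (maxSize_stateAfter_le_mkspan I τ le_rfl) i k
  have hsum := (sum_load I (algAssign safeAlg I) k).trans (sum_load I τ k).symm
  rw [Fin.sum_univ_two, Fin.sum_univ_two] at hsum
  rw [hload, hload, hsum]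
  linarith [load_le_mkspan I τ 0 k, load_le_mkspan I τ 1 k]

end

/-- **Theorem.** There is a `5/3`-competitive deterministic online algorithm for
`OMSS(2,2)`. -/
theorem exists_five_thirds_competitive_algorithm :
    ∃ A : OnlineAlg 2 2, ∀ I : OMSSInstance 2,
      mkspan I (algAssign A I) ≤ (5 / 3 : ℝ) * OPT 2 I := by
  refine ⟨safeAlg, fun I ↦ csSup_le ⟨_, 0, 0, rfl⟩ ?_⟩
  rintro _ ⟨k, i, rfl⟩
  have h : 3 / 5 * load I (algAssign safeAlg I) i k ≤ OPT 2 I := by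
    refine le_csInf ⟨_, fun _ ↦ 0, rfl⟩ ?_
    rintro _ ⟨τ, rfl⟩
    linarith [load_algAssign_safeAlg_le I τ i k]
  linarith
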